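/- arXiv:1602.05542 — 3 statements merged into one kernel-verified Lean document; each statement's English description precedes it below -/
import Mathlib

section
/- Let l and m be positive integers and let k_1, …, k_l be positive integers satisfying k_1 + ⋯ + k_l − 2 ≥ m·(l − 2) (as an inequality of integers). For each h ∈ {1,…,l} let π_h be a partition of the number m into exactly k_h parts. Then there exist set partitions Π_1, …, Π_l of the set {1,…,m} such that Π_h realizes π_h for every h and the family Π_1, …, Π_l has the triple intersection property. -/
open Finset in
/-- A function on `Fin m` whose multiset of values is the image of `S` under `w` lifts through `w`
to an enumeration of `S`. -/
theorem exists_lift_of_map_eq {σ κ : Type*} (w : σ → κ) :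
    ∀ {m : ℕ} (f : Fin m → κ) (S : Multiset σ),
      S.map w = (univ : Finset (Fin m)).val.map f →
      ∃ g : Fin m → σ, (univ : Finset (Fin m)).val.map g = S ∧ ∀ x, w (g x) = f x := by
  classical
  intro m
  induction m with
  | zero =>
    intro f S h
    refine ⟨Fin.elim0, ?_, fun x => x.elim0⟩
    have hS : S = 0 := by simpa using h
    simp [hS]
  | succ n ih =>
    intro f S h
    have hf : (univ : Finset (Fin (n + 1))).val.map f
        = f 0 ::ₘ (univ : Finset (Fin n)).val.map (fun x => f x.succ) := by
      simp only [Fin.univ_val_map, List.ofFn_succ, Multiset.cons_coe]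
    rw [hf, ← Multiset.map_eq_cons] at h
    obtain ⟨s, hs, hw, hT⟩ := h
    obtain ⟨g, hg, hgw⟩ := ih _ _ hT
    refine ⟨Fin.cons s g, ?_, fun x => ?_⟩
    · rw [← Multiset.cons_erase hs, ← hg]
      simp only [Fin.univ_val_map, List.ofFn_succ, Multiset.cons_coe, Fin.cons_zero, Fin.cons_succ]
    · cases x using Fin.cases with
      | zero => simpa using hw
      | succ x => simpa using hgw x

/-- Every multiset of cardinality `m` is enumerated by a function on `Fin m`. -/
theorem exists_enumeration {σ : Type*} {m : ℕ} (S : Multiset σ) (hS : S.card = m) :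
    ∃ g : Fin m → σ, (Finset.univ : Finset (Fin m)).val.map g = S := by
  obtain ⟨g, hg, -⟩ := exists_lift_of_map_eq (fun _ : σ => ()) (fun _ : Fin m => ()) S
    (by simp [hS])
  exact ⟨g, hg⟩

theorem injective_of_nodup_map_univ {σ : Type*} {m : ℕ} {g : Fin m → σ}
    (h : ((Finset.univ : Finset (Fin m)).val.map g).Nodup) : Function.Injective g :=
  fun x y hxy => Multiset.inj_on_of_nodup_map h x (Finset.mem_univ x) y (Finset.mem_univ y) hxy

namespace Multiset

variable {α : Type*} [DecidableEq α]

theorem mul_card_toFinset_le_card {A : Multiset α} {c : ℕ} (h : ∀ i ∈ A, c ≤ A.count i) :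
    c * A.toFinset.card ≤ A.card := by
  rw [← Multiset.toFinset_sum_count_eq, mul_comm, ← smul_eq_mul]
  exact Finset.card_nsmul_le_sum _ _ _ fun i hi => h i (Multiset.mem_toFinset.1 hi)

theorem exists_two_le_count {A : Multiset α} (h : ¬ A.Nodup) : ∃ i, 2 ≤ A.count i := by
  rw [Multiset.nodup_iff_count_le_one] at h
  push Not at h
  exact h

theorem exists_eq_cons_of_count_eq_one {A : Multiset α} {i : α} (h : A.count i = 1) :
    ∃ A', A = i ::ₘ A' ∧ i ∉ A' := by
  obtain ⟨A', rfl⟩ := Multiset.exists_cons_of_mem (Multiset.count_pos.1 (by omega : 0 < A.count i))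
  refine ⟨A', rfl, fun hi => ?_⟩
  have := Multiset.count_pos.2 hi
  rw [Multiset.count_cons_self] at h
  omega

theorem exists_eq_cons_of_two_le_count {A : Multiset α} {i : α} (h : 2 ≤ A.count i) :
    ∃ A', A = i ::ₘ A' ∧ i ∈ A' := by
  obtain ⟨A', rfl⟩ := Multiset.exists_cons_of_mem (Multiset.count_pos.1 (by omega : 0 < A.count i))
  refine ⟨A', rfl, Multiset.count_pos.1 ?_⟩
  rw [Multiset.count_cons_self] at h
  omega

theorem card_toFinset_cons_of_mem {A : Multiset α} {i : α} (h : i ∈ A) :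
    (i ::ₘ A).toFinset.card = A.toFinset.card := by
  rw [Multiset.toFinset_cons, Finset.insert_eq_of_mem (Multiset.mem_toFinset.2 h)]

theorem card_toFinset_cons_of_notMem {A : Multiset α} {i : α} (h : i ∉ A) :
    (i ::ₘ A).toFinset.card = A.toFinset.card + 1 := by
  rw [Multiset.toFinset_cons, Finset.card_insert_of_notMem (by simpa using h)]

theorem card_toFinset_cons_le (A : Multiset α) (i : α) :
    (i ::ₘ A).toFinset.card ≤ A.toFinset.card + 1 := by
  rw [Multiset.toFinset_cons]
  exact Finset.card_insert_le _ _

theorem exists_map_fst_snd {β γ : Type*} (A : Multiset β) (B : Multiset γ)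
    (h : A.card = B.card) :
    ∃ S : Multiset (β × γ), S.map Prod.fst = A ∧ S.map Prod.snd = B := by
  obtain ⟨f, hf⟩ := exists_enumeration A rfl
  obtain ⟨g, hg⟩ := exists_enumeration B h.symm
  exact ⟨(Finset.univ : Finset (Fin A.card)).val.map fun x => (f x, g x),
    by rw [Multiset.map_map]; exact hf, by rw [Multiset.map_map]; exact hg⟩

end Multiset

/-- The multisets `A` and `B` are the two marginals of a bipartite graph (with edge set `S`) having
at least `#A + #B - |A|` components; `u` and `v` label the components. -/
def HasForestPairing (A B : Multiset ℕ) : Prop :=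
  ∃ S : Multiset (ℕ × ℕ), S.Nodup ∧ S.map Prod.fst = A ∧ S.map Prod.snd = B ∧
    ∃ u v : ℕ → ℕ, (∀ p ∈ S, u p.1 = v p.2) ∧
      A.toFinset.card + B.toFinset.card ≤ (A.map u).toFinset.card + A.card

theorem HasForestPairing.symm {A B : Multiset ℕ} (h : HasForestPairing A B) :
    HasForestPairing B A := by
  obtain ⟨S, hS, rfl, rfl, u, v, huv, hc⟩ := h
  refine ⟨S.map Prod.swap, hS.map Prod.swap_injective, ?_, ?_, v, u, ?_, ?_⟩
  · rw [Multiset.map_map]; rfl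
  · rw [Multiset.map_map]; rfl
  · simp only [Multiset.mem_map]
    rintro _ ⟨p, hp, rfl⟩
    exact (huv p hp).symm
  · have : (S.map Prod.snd).map v = (S.map Prod.fst).map u := by
      simp only [Multiset.map_map]
      exact Multiset.map_congr rfl fun p hp => (huv p hp).symm
    rw [this, add_comm]
    simpa using hc

theorem HasForestPairing.of_nodup_right {A B : Multiset ℕ} (h : A.card = B.card) (hB : B.Nodup) :
    HasForestPairing A B := by
  classical
  obtain ⟨S, rfl, rfl⟩ := Multiset.exists_map_fst_snd A B h
  refine ⟨S, hB.of_map, rfl, rfl, id,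
    fun j => if h : ∃ i, (i, j) ∈ S then h.choose else 0, ?_, ?_⟩
  · rintro ⟨i, j⟩ hp
    have hex : ∃ i, (i, j) ∈ S := ⟨i, hp⟩
    have := Multiset.inj_on_of_nodup_map hB _ hex.choose_spec _ hp rfl
    simp only [dif_pos hex, id]
    exact (congrArg Prod.fst this).symm
  · rw [Multiset.map_id, h]
    exact Nat.add_le_add_left (Multiset.toFinset_card_le _) _

theorem HasForestPairing.cons {A B : Multiset ℕ} {i j : ℕ} (hi : i ∉ A) (hj : j ∈ B)
    (h : HasForestPairing A B) : HasForestPairing (i ::ₘ A) (j ::ₘ B) := by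
  obtain ⟨S, hS, rfl, rfl, u, v, huv, hc⟩ := h
  have hne : ∀ p ∈ S, p.1 ≠ i := fun p hp hpi => hi (Multiset.mem_map.2 ⟨p, hp, hpi⟩)
  refine ⟨(i, j) ::ₘ S, Multiset.nodup_cons.2 ⟨fun hp => hne _ hp rfl, hS⟩, by simp, by simp,
    Function.update u i (v j), v, ?_, ?_⟩
  · intro p hp
    rcases Multiset.mem_cons.1 hp with rfl | hp
    · simp
    · rw [Function.update_of_ne (hne p hp), huv p hp]
  · rw [Multiset.card_toFinset_cons_of_notMem hi, Multiset.card_toFinset_cons_of_mem hj,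
      Multiset.map_cons, Multiset.card_cons]
    have hmap : (S.map Prod.fst).map (Function.update u i (v j)) = (S.map Prod.fst).map u := by
      simp only [Multiset.map_map]
      exact Multiset.map_congr rfl fun p hp => Function.update_of_ne (hne p hp) _ _
    rw [hmap]
    have hle := Finset.card_le_card (Multiset.toFinset_subset.2
      (Multiset.subset_cons ((S.map Prod.fst).map u) (Function.update u i (v j) i)))
    omega

theorem hasForestPairing_of_card_lt {A B : Multiset ℕ} (hAB : A.card = B.card)
    (h : A.card < A.toFinset.card + B.toFinset.card) : HasForestPairing A B := by
  induction hm : A.card generalizing A B with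
  | zero =>
    have hB : B = 0 := Multiset.card_eq_zero.1 (hAB ▸ hm)
    exact .of_nodup_right hAB (hB ▸ Multiset.nodup_zero)
  | succ m ih =>
    have key : ∀ A B : Multiset ℕ, A.card = B.card →
        A.card < A.toFinset.card + B.toFinset.card → A.card = m + 1 → ¬ B.Nodup →
        (∃ i, A.count i = 1) → HasForestPairing A B := by
      rintro A B hAB h hm hB ⟨i, hi⟩
      obtain ⟨j, hj⟩ := Multiset.exists_two_le_count hB
      obtain ⟨A, rfl, hiA⟩ := Multiset.exists_eq_cons_of_count_eq_one hi
      obtain ⟨B, rfl, hjB⟩ := Multiset.exists_eq_cons_of_two_le_count hj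
      rw [Multiset.card_toFinset_cons_of_notMem hiA, Multiset.card_toFinset_cons_of_mem hjB] at h
      simp only [Multiset.card_cons] at hAB hm h
      exact (ih (by omega) (by omega) (by omega)).cons hiA hjB
    by_cases hB : B.Nodup
    · exact .of_nodup_right hAB hB
    by_cases hA : A.Nodup
    · exact (HasForestPairing.of_nodup_right hAB.symm hA).symm
    by_cases hA1 : ∃ i, A.count i = 1
    · exact key A B hAB h hm hB hA1
    by_cases hB1 : ∃ i, B.count i = 1
    · exact (key B A hAB.symm (by omega) (by omega) hA hB1).symm
    push Not at hA1 hB1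
    have h1 := Multiset.mul_card_toFinset_le_card (A := A) (c := 2) fun i hi => by
      have := Multiset.count_pos.2 hi
      have := hA1 i
      omega
    have h2 := Multiset.mul_card_toFinset_le_card (A := B) (c := 2) fun i hi => by
      have := Multiset.count_pos.2 hi
      have := hB1 i
      omega
    omega

/-- There is a set of triples with the three given marginals. -/
def HasTripling (A B C : Multiset ℕ) : Prop :=
  ∃ S : Multiset (ℕ × ℕ × ℕ), S.Nodup ∧ S.map (fun p => p.1) = A ∧
    S.map (fun p => p.2.1) = B ∧ S.map (fun p => p.2.2) = C

namespace HasTripling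

variable {A B C : Multiset ℕ}

theorem swap_left (h : HasTripling A B C) : HasTripling B A C := by
  obtain ⟨S, hS, rfl, rfl, rfl⟩ := h
  refine ⟨S.map fun p => (p.2.1, p.1, p.2.2), hS.map ?_, ?_, ?_, ?_⟩
  · rintro ⟨a, b, c⟩ ⟨a', b', c'⟩ h
    simp only [Prod.mk.injEq] at h ⊢
    tauto
  all_goals simp [Multiset.map_map]

theorem swap_right (h : HasTripling A B C) : HasTripling A C B := by
  obtain ⟨S, hS, rfl, rfl, rfl⟩ := h
  refine ⟨S.map fun p => (p.1, p.2.2, p.2.1), hS.map ?_, ?_, ?_, ?_⟩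
  · rintro ⟨a, b, c⟩ ⟨a', b', c'⟩ h
    simp only [Prod.mk.injEq] at h ⊢
    tauto
  all_goals simp [Multiset.map_map]

theorem of_nodup (hAB : A.card = B.card) (hAC : A.card = C.card) (hA : A.Nodup) :
    HasTripling A B C := by
  obtain ⟨T, rfl, rfl⟩ := Multiset.exists_map_fst_snd B C (hAB.symm.trans hAC)
  obtain ⟨S, rfl, rfl⟩ := Multiset.exists_map_fst_snd A T (by simpa using hAB)
  exact ⟨S, hA.of_map, rfl, by simp [Multiset.map_map], by simp [Multiset.map_map]⟩

theorem cons {i : ℕ} (hi : i ∉ A) (j k : ℕ) (h : HasTripling A B C) :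
    HasTripling (i ::ₘ A) (j ::ₘ B) (k ::ₘ C) := by
  obtain ⟨S, hS, rfl, rfl, rfl⟩ := h
  refine ⟨(i, j, k) ::ₘ S, Multiset.nodup_cons.2 ⟨fun hp => hi ?_, hS⟩, ?_, ?_, ?_⟩
  · exact Multiset.mem_map.2 ⟨_, hp, rfl⟩
  all_goals simp

theorem cons_cons {i j j' : ℕ} (hi : i ∉ A) (hj : j ≠ j') (k k' : ℕ) (h : HasTripling A B C) :
    HasTripling (i ::ₘ i ::ₘ A) (j ::ₘ j' ::ₘ B) (k ::ₘ k' ::ₘ C) := by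
  obtain ⟨S, hS, rfl, rfl, rfl⟩ := h
  have hn : ∀ j k, (i, j, k) ∉ S := fun j k hp => hi (Multiset.mem_map.2 ⟨_, hp, rfl⟩)
  refine ⟨(i, j, k) ::ₘ (i, j', k') ::ₘ S, ?_, ?_, ?_, ?_⟩
  · simp only [Multiset.nodup_cons, Multiset.mem_cons, Prod.mk.injEq, not_or]
    exact ⟨⟨fun h => hj h.2.1, hn _ _⟩, hn _ _, hS⟩
  all_goals simp

end HasTripling

theorem hasTripling_of_card_add_two_le {A B C : Multiset ℕ} (hAB : A.card = B.card)
    (hAC : A.card = C.card)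
    (h : A.card + 2 ≤ A.toFinset.card + B.toFinset.card + C.toFinset.card) :
    HasTripling A B C := by
  induction hm : A.card using Nat.strong_induction_on generalizing A B C with
  | _ m ih =>
  have one : ∀ A B C : Multiset ℕ, A.card = B.card → A.card = C.card →
      A.card + 2 ≤ A.toFinset.card + B.toFinset.card + C.toFinset.card → A.card = m →
      ¬ B.Nodup → ¬ C.Nodup → (∃ i, A.count i = 1) → HasTripling A B C := by
    rintro A B C hAB hAC h hm hB hC ⟨i, hi⟩
    obtain ⟨j, hj⟩ := Multiset.exists_two_le_count hB
    obtain ⟨k, hk⟩ := Multiset.exists_two_le_count hC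
    obtain ⟨A, rfl, hiA⟩ := Multiset.exists_eq_cons_of_count_eq_one hi
    obtain ⟨B, rfl, hjB⟩ := Multiset.exists_eq_cons_of_two_le_count hj
    obtain ⟨C, rfl, hkC⟩ := Multiset.exists_eq_cons_of_two_le_count hk
    rw [Multiset.card_toFinset_cons_of_notMem hiA, Multiset.card_toFinset_cons_of_mem hjB,
      Multiset.card_toFinset_cons_of_mem hkC] at h
    simp only [Multiset.card_cons] at hAB hAC hm h
    exact (ih A.card (by omega) (by omega) (by omega) (by omega) rfl).cons hiA j k
  by_cases hA : A.Nodup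
  · exact .of_nodup hAB hAC hA
  by_cases hB : B.Nodup
  · exact (HasTripling.of_nodup hAB.symm (hAB.symm.trans hAC) hB).swap_left
  by_cases hC : C.Nodup
  · exact (HasTripling.of_nodup hAC.symm (hAC.symm.trans hAB) hC).swap_left.swap_right
  by_cases hA1 : ∃ i, A.count i = 1
  · exact one A B C hAB hAC h hm hB hC hA1
  by_cases hB1 : ∃ i, B.count i = 1
  · exact (one B A C hAB.symm (by omega) (by omega) (by omega) hA hC hB1).swap_left
  by_cases hC1 : ∃ i, C.count i = 1
  · exact (one C A B hAC.symm (by omega) (by omega) (by omega) hA hB hC1).swap_left.swap_right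
  have htwo : ∀ A : Multiset ℕ, (¬ ∃ i, A.count i = 1) → ∀ i ∈ A, 2 ≤ A.count i := by
    intro A hA i hi
    have := Multiset.count_pos.2 hi
    have : A.count i ≠ 1 := fun h => hA ⟨i, h⟩
    omega
  replace hA1 := htwo A hA1
  replace hB1 := htwo B hB1
  replace hC1 := htwo C hC1
  have two : ∀ A B C : Multiset ℕ, A.card = B.card → A.card = C.card →
      A.card + 2 ≤ A.toFinset.card + B.toFinset.card + C.toFinset.card → A.card = m →
      (∀ j ∈ B, 2 ≤ B.count j) → ¬ C.Nodup → (∃ i, A.count i = 2) → 1 < B.toFinset.card →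
      HasTripling A B C := by
    rintro A B C hAB hAC h hm hB hC ⟨i, hi⟩ hB2
    obtain ⟨k, hk⟩ := Multiset.exists_two_le_count hC
    obtain ⟨A, rfl, hiA⟩ := Multiset.exists_eq_cons_of_two_le_count hi.ge
    rw [Multiset.count_cons_self] at hi
    obtain ⟨A, rfl, hiA'⟩ := Multiset.exists_eq_cons_of_count_eq_one (by omega : A.count i = 1)
    obtain ⟨C, rfl, hkC⟩ := Multiset.exists_eq_cons_of_two_le_count hk
    rw [Multiset.card_toFinset_cons_of_mem hkC] at h
    obtain ⟨C, rfl⟩ := Multiset.exists_cons_of_mem hkC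
    have hC' := Multiset.card_toFinset_cons_le C k
    obtain ⟨j, hj, j', hj', hjj⟩ := Finset.one_lt_card.1 hB2
    rw [Multiset.mem_toFinset] at hj hj'
    have hjc := hB j hj
    have hjc' := hB j' hj'
    obtain ⟨B, rfl, hjB⟩ := Multiset.exists_eq_cons_of_two_le_count hjc
    rw [Multiset.count_cons_of_ne hjj.symm] at hjc'
    obtain ⟨B, rfl, hjB'⟩ := Multiset.exists_eq_cons_of_two_le_count hjc'
    rw [Multiset.card_toFinset_cons_of_mem hiA, Multiset.card_toFinset_cons_of_notMem hiA',
      Multiset.card_toFinset_cons_of_mem hjB, Multiset.card_toFinset_cons_of_mem hjB'] at h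
    simp only [Multiset.card_cons] at hAB hAC hm h
    exact (ih A.card (by omega) (by omega) (by omega) (by omega) rfl).cons_cons hiA' hjj k k
  have two' : ∀ A B C : Multiset ℕ, A.card = B.card → A.card = C.card →
      A.card + 2 ≤ A.toFinset.card + B.toFinset.card + C.toFinset.card → A.card = m →
      (∀ i ∈ A, 2 ≤ A.count i) → (∀ j ∈ B, 2 ≤ B.count j) → (∀ k ∈ C, 2 ≤ C.count k) →
      ¬ B.Nodup → ¬ C.Nodup → (∃ i, A.count i = 2) → HasTripling A B C := by
    intro A B C hAB hAC h hm hA2 hB2 hC2 hB hC hi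
    by_cases hB3 : 1 < B.toFinset.card
    · exact two A B C hAB hAC h hm hB2 hC hi hB3
    by_cases hC3 : 1 < C.toFinset.card
    · exact (two A C B hAC hAB (by omega) hm hC2 hB hi hC3).swap_right
    obtain ⟨i, hi⟩ := hi
    have := Multiset.count_le_card i A
    have := Multiset.mul_card_toFinset_le_card hA2
    omega
  by_cases hA2 : ∃ i, A.count i = 2
  · exact two' A B C hAB hAC h hm hA1 hB1 hC1 hB hC hA2
  by_cases hB2 : ∃ i, B.count i = 2
  · exact (two' B A C hAB.symm (by omega) (by omega) (by omega) hB1 hA1 hC1 hA hC hB2).swap_left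
  by_cases hC2 : ∃ i, C.count i = 2
  · exact (two' C A B hAC.symm (by omega) (by omega) (by omega) hC1 hA1 hB1 hA hB
      hC2).swap_left.swap_right
  have hthree : ∀ A : Multiset ℕ, (∀ i ∈ A, 2 ≤ A.count i) → (¬ ∃ i, A.count i = 2) →
      3 * A.toFinset.card ≤ A.card := by
    refine fun A hA hA' => Multiset.mul_card_toFinset_le_card fun i hi => ?_
    have := hA i hi
    have : A.count i ≠ 2 := fun h => hA' ⟨i, h⟩
    omega
  have := hthree A hA1 hA2
  have := hthree B hB1 hB2
  have := hthree C hC1 hC2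
  omega

/-- Labellings of `Fin m` with prescribed multisets of values, any three of which jointly separate
points. -/
theorem exists_labellings_separating {ι : Type*} [Fintype ι] [DecidableEq ι] {m : ℕ}
    (A : ι → Multiset ℕ) (hA : ∀ h, (A h).card = m)
    (hd : ∑ h, (m - (A h).toFinset.card) + 2 ≤ 2 * m) :
    ∃ f : ι → Fin m → ℕ, (∀ h, (Finset.univ : Finset (Fin m)).val.map (f h) = A h) ∧
      ∀ T : Finset ι, T.card = 3 → ∀ x y, (∀ h ∈ T, f h x = f h y) → x = y := by
  induction hn : (Finset.univ.filter fun h => ¬ (A h).Nodup).card using Nat.strong_induction_on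
    generalizing A with
  | _ n ih =>
  set N : Finset ι := Finset.univ.filter fun h => ¬ (A h).Nodup with hN
  have hmem : ∀ h, h ∈ N ↔ ¬ (A h).Nodup := fun h => by simp [hN]
  have hle : ∀ h, (A h).toFinset.card ≤ m := fun h => hA h ▸ Multiset.toFinset_card_le _
  have hsub : ∀ s : Finset ι,
      ∑ h ∈ s, (m - (A h).toFinset.card) ≤ ∑ h, (m - (A h).toFinset.card) := fun s =>
    Finset.sum_le_sum_of_subset (Finset.subset_univ s)
  choose e he using fun h => exists_enumeration (A h) (hA h)
  have hinj : ∀ h, h ∉ N → ∀ f : Fin m → ℕ,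
      (Finset.univ : Finset (Fin m)).val.map f = A h → Function.Injective f := by
    intro h hh f hf
    refine injective_of_nodup_map_univ ?_
    rw [hf]
    by_contra hc
    exact hh ((hmem h).2 hc)
  rcases lt_trichotomy N.card 3 with hlt | heq | hgt
  · refine ⟨e, he, fun T hT x y hxy => ?_⟩
    obtain ⟨h, hhT, hhN⟩ := Finset.exists_mem_notMem_of_card_lt_card (hT ▸ hlt)
    exact hinj h hhN _ (he h) (hxy h hhT)
  · obtain ⟨p, q, r, hpq, hpr, hqr, hNe⟩ := Finset.card_eq_three.1 heq
    have hs := hsub {p, q, r}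
    rw [Finset.sum_insert (by simp [hpq, hpr]), Finset.sum_pair hqr] at hs
    have hp := hle p
    have hq := hle q
    have hr := hle r
    obtain ⟨S, hS, hSp, hSq, hSr⟩ : HasTripling (A p) (A q) (A r) :=
      hasTripling_of_card_add_two_le (by simp [hA]) (by simp [hA]) (by rw [hA]; omega)
    obtain ⟨g, hg⟩ := exists_enumeration (m := m) S (by rw [← hA p, ← hSp, Multiset.card_map])
    have hginj : Function.Injective g := injective_of_nodup_map_univ (hg ▸ hS)
    let f : ι → Fin m → ℕ := fun h => if h = p then fun x => (g x).1 else
      if h = q then fun x => (g x).2.1 else if h = r then fun x => (g x).2.2 else e h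
    have hfp : f p = fun x => (g x).1 := by simp [f]
    have hfq : f q = fun x => (g x).2.1 := by simp [f, hpq.symm]
    have hfr : f r = fun x => (g x).2.2 := by simp [f, hpr.symm, hqr.symm]
    have hf : ∀ h, (Finset.univ : Finset (Fin m)).val.map (f h) = A h := by
      intro h
      by_cases h1 : h = p
      · rw [h1, hfp, ← hSp, ← hg, Multiset.map_map]; rfl
      by_cases h2 : h = q
      · rw [h2, hfq, ← hSq, ← hg, Multiset.map_map]; rfl
      by_cases h3 : h = r
      · rw [h3, hfr, ← hSr, ← hg, Multiset.map_map]; rfl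
      simp only [f, h1, h2, h3, if_false]
      exact he h
    refine ⟨f, hf, fun T hT x y hxy => ?_⟩
    by_cases hTN : T ⊆ N
    · have hTe : T = {p, q, r} := hNe ▸ Finset.eq_of_subset_of_card_le hTN (by omega)
      have hxp := hxy p (by simp [hTe])
      have hxq := hxy q (by simp [hTe])
      have hxr := hxy r (by simp [hTe])
      rw [hfp] at hxp
      rw [hfq] at hxq
      rw [hfr] at hxr
      exact hginj (Prod.ext hxp (Prod.ext hxq hxr))
    · obtain ⟨h, hhT, hhN⟩ := Finset.not_subset.1 hTN
      exact hinj h hhN _ (hf h) (hxy h hhT)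
  · obtain ⟨p, hpN, q, hqN, hpq, hsum⟩ : ∃ p ∈ N, ∃ q ∈ N, p ≠ q ∧
        m < (A p).toFinset.card + (A q).toFinset.card := by
      obtain ⟨p, hp, q, hq, hpq⟩ := Finset.one_lt_card.1 (by omega : 1 < N.card)
      have hc : 1 < ((N.erase p).erase q).card := by
        rw [Finset.card_erase_of_mem (Finset.mem_erase.2 ⟨hpq.symm, hq⟩),
          Finset.card_erase_of_mem hp]
        omega
      obtain ⟨r, hr, s, hs, hrs⟩ := Finset.one_lt_card.1 hc
      simp only [Finset.mem_erase] at hr hs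
      have hS := hsub {p, q, r, s}
      rw [Finset.sum_insert (by simp [hpq, hr.2.1.symm, hs.2.1.symm]),
        Finset.sum_insert (by simp [hr.1.symm, hs.1.symm]), Finset.sum_pair hrs] at hS
      by_cases hlt : m < (A p).toFinset.card + (A q).toFinset.card
      · exact ⟨p, hp, q, hq, hpq, hlt⟩
      · have := hle p
        have := hle q
        have := hle r
        have := hle s
        exact ⟨r, hr.2.2, s, hs.2.2, hrs, by omega⟩
    obtain ⟨S, hS, hSp, hSq, u, v, huv, hc⟩ :=
      hasForestPairing_of_card_lt (A := A p) (B := A q) (by simp [hA]) (by rwa [hA])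
    let A' : ι → Multiset ℕ := Function.update (Function.update A p ((A p).map u)) q
      (Multiset.range m)
    have hA'p : A' p = (A p).map u := by simp [A', hpq]
    have hA'q : A' q = Multiset.range m := by simp [A']
    have hA'h : ∀ h, h ≠ p → h ≠ q → A' h = A h := fun h h1 h2 => by simp [A', h1, h2]
    have hA' : ∀ h, (A' h).card = m := by
      intro h
      by_cases h1 : h = p
      · simp [h1, hA'p, hA]
      by_cases h2 : h = q
      · simp [h2, hA'q]
      rw [hA'h h h1 h2, hA]
    have hd' : ∑ h, (m - (A' h).toFinset.card) + 2 ≤ 2 * m := by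
      refine le_trans (Nat.add_le_add_right ?_ 2) hd
      have hqe : q ∈ Finset.univ.erase p := by simp [hpq.symm]
      rw [← Finset.add_sum_erase _ _ (Finset.mem_univ p), ← Finset.add_sum_erase _ _ hqe,
        ← Finset.add_sum_erase _ _ (Finset.mem_univ p), ← Finset.add_sum_erase _ _ hqe]
      have hrest : ∑ h ∈ (Finset.univ.erase p).erase q, (m - (A' h).toFinset.card)
          = ∑ h ∈ (Finset.univ.erase p).erase q, (m - (A h).toFinset.card) := by
        refine Finset.sum_congr rfl fun h hh => ?_
        simp only [Finset.mem_erase] at hh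
        rw [hA'h h hh.2.1 hh.1]
      have hq0 : (A' q).toFinset.card = m := by
        rw [hA'q, Multiset.toFinset_card_of_nodup (Multiset.nodup_range m), Multiset.card_range]
      have := hle p
      have := hle q
      rw [hA p] at hc
      rw [hrest, hq0, hA'p]
      omega
    have hlt : (Finset.univ.filter fun h => ¬ (A' h).Nodup).card < n := by
      rw [← hn]
      refine Finset.card_lt_card (Finset.ssubset_iff_of_subset ?_ |>.2 ⟨q, hqN, ?_⟩)
      · intro h hh
        rw [Finset.mem_filter] at hh
        by_cases h1 : h = p
        · rwa [h1]
        by_cases h2 : h = q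
        · rwa [h2]
        rw [hmem, ← hA'h h h1 h2]
        exact hh.2
      · simp [hA'q, Multiset.nodup_range]
    obtain ⟨f, hf, hfT⟩ := ih _ hlt A' hA' hd' rfl
    obtain ⟨g, hg, hgf⟩ := exists_lift_of_map_eq (fun s : ℕ × ℕ => u s.1) (f p) S
      (by rw [hf, hA'p, ← hSp, Multiset.map_map]; rfl)
    have hginj : Function.Injective g := injective_of_nodup_map_univ (hg ▸ hS)
    have hgS : ∀ x, g x ∈ S := fun x => hg ▸ Multiset.mem_map_of_mem g (Finset.mem_univ x)
    let F : ι → Fin m → ℕ := Function.update (Function.update f p fun x => (g x).1) q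
      fun x => (g x).2
    have hFp : F p = fun x => (g x).1 := by simp [F, hpq]
    have hFq : F q = fun x => (g x).2 := by simp [F]
    have hFh : ∀ h, h ≠ p → h ≠ q → F h = f h := fun h h1 h2 => by simp [F, h1, h2]
    have hpf : ∀ x y, F p x = F p y → f p x = f p y := by
      intro x y hxy
      simp only [hFp] at hxy
      rw [← hgf, ← hgf, hxy]
    have hqf : ∀ x y, F q x = F q y → f p x = f p y := by
      intro x y hxy
      simp only [hFq] at hxy
      rw [← hgf, ← hgf, huv _ (hgS x), huv _ (hgS y), hxy]
    refine ⟨F, fun h => ?_, fun T hT x y hxy => ?_⟩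
    · by_cases h1 : h = p
      · rw [h1, hFp, ← hSp, ← hg, Multiset.map_map]; rfl
      by_cases h2 : h = q
      · rw [h2, hFq, ← hSq, ← hg, Multiset.map_map]; rfl
      rw [hFh h h1 h2, hf, hA'h h h1 h2]
    · by_cases hqT : q ∈ T
      · by_cases hpT : p ∈ T
        · have h1 := hxy p hpT
          have h2 := hxy q hqT
          rw [hFp] at h1
          rw [hFq] at h2
          exact hginj (Prod.ext h1 h2)
        · refine hfT (insert p (T.erase q)) ?_ x y fun h hh => ?_
          · rw [Finset.card_insert_of_notMem (by simp [hpT]), Finset.card_erase_of_mem hqT, hT]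
          · rw [Finset.mem_insert, Finset.mem_erase] at hh
            rcases hh with rfl | ⟨hhq, hhT⟩
            · exact hqf x y (hxy q hqT)
            · have hhp : h ≠ p := fun hhp => hpT (hhp ▸ hhT)
              rw [← hFh h hhp hhq]
              exact hxy h hhT
      · refine hfT T hT x y fun h hh => ?_
        by_cases h1 : h = p
        · rw [h1] at hh ⊢
          exact hpf x y (hxy p hh)
        · rw [← hFh h h1 fun h2 => hqT (h2 ▸ hh)]
          exact hxy h hh

/-- Every multiset of positive integers is the multiset of multiplicities of some multiset. -/
theorem exists_multiset_with_counts (π : Multiset ℕ) (hpos : ∀ x ∈ π, 0 < x) :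
    ∃ A : Multiset ℕ, A.toFinset.val.map A.count = π := by
  induction π using Multiset.induction with
  | empty => exact ⟨0, by simp⟩
  | cons a π ih =>
    obtain ⟨A, hA⟩ := ih fun x hx => hpos x (Multiset.mem_cons_of_mem hx)
    obtain ⟨n, hn⟩ := Infinite.exists_notMem_finset A.toFinset
    have ha : a ≠ 0 := (hpos a (Multiset.mem_cons_self a π)).ne'
    refine ⟨Multiset.replicate a n + A, ?_⟩
    have hset : (Multiset.replicate a n + A).toFinset = insert n A.toFinset := by
      rw [Multiset.toFinset_add, Multiset.toFinset_replicate, if_neg ha, Finset.insert_eq]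
    rw [hset, Finset.insert_val_of_notMem hn, Multiset.map_cons, ← hA]
    congr 1
    · have : A.count n = 0 := Multiset.count_eq_zero.2 fun h => hn (Multiset.mem_toFinset.2 h)
      simp [this]
    · refine Multiset.map_congr rfl fun i hi => ?_
      have hni : n ≠ i := fun h => hn (h ▸ hi)
      simp [Multiset.count_replicate, hni]

/-- The partition of `Fin m` into the fibres of a function. -/
theorem exists_finpartition_fibers {m : ℕ} (f : Fin m → ℕ) (A : Multiset ℕ)
    (hf : (Finset.univ : Finset (Fin m)).val.map f = A) :
    ∃ P : Finpartition (Finset.univ : Finset (Fin m)),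
      P.parts.val.map Finset.card = A.toFinset.val.map A.count ∧
      ∀ B ∈ P.parts, ∀ x ∈ B, ∀ y ∈ B, f x = f y := by
  subst hf
  set A : Multiset ℕ := (Finset.univ : Finset (Fin m)).val.map f with hA
  let F : ℕ → Finset (Fin m) := fun i => Finset.univ.filter fun x => f x = i
  have hmem : ∀ i ∈ A.toFinset, ∃ x, f x = i := fun i hi => by simpa [hA] using hi
  have hFinj : Set.InjOn F A.toFinset := by
    intro i hi j _ hij
    obtain ⟨x, rfl⟩ := hmem i hi
    have hx : x ∈ F j := hij ▸ by simp [F]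
    simpa [F] using hx
  refine ⟨Finpartition.ofExistsUnique (A.toFinset.image F) (fun _ _ => Finset.subset_univ _)
    (fun x _ => ⟨F (f x), ⟨Finset.mem_image_of_mem _ (by simp [hA]), by simp [F]⟩, ?_⟩) ?_,
    ?_, ?_⟩
  · rintro _ ⟨hB, hx⟩
    obtain ⟨i, -, rfl⟩ := Finset.mem_image.1 hB
    have : f x = i := by simpa [F] using hx
    rw [this]
  · intro h
    obtain ⟨i, hi, hempty⟩ := Finset.mem_image.1 h
    obtain ⟨x, rfl⟩ := hmem i hi
    have hx : x ∈ F (f x) := by simp [F]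
    simp [hempty] at hx
  · change (A.toFinset.image F).val.map Finset.card = _
    rw [Finset.image_val_of_injOn hFinj, Multiset.map_map]
    refine Multiset.map_congr rfl fun i _ => ?_
    rw [hA, Multiset.count_map]
    simp only [Function.comp, F, Finset.card_def, Finset.filter_val, eq_comm]
  · intro B hB x hx y hy
    obtain ⟨i, -, rfl⟩ := Finset.mem_image.1 (show B ∈ A.toFinset.image F from hB)
    simp only [F, Finset.mem_filter] at hx hy
    exact hx.2.trans hy.2.symm


/-- **Partition lemma with the triple intersection property.**
Let `l`, `m` be positive integers and `k 0, …, k (l-1)` positive integers with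
`k 0 + ⋯ + k (l-1) - 2 ≥ m * (l - 2)` (in `ℤ`).  For each `h` let `π h` be a partition of the
number `m` into exactly `k h` (positive) parts.  Then there exist set partitions
`Π 0, …, Π (l-1)` of `{1, …, m}` (formalized as `Fin m`) such that the multiset of block sizes
of `Π h` is `π h` for every `h`, and such that any three blocks taken from three pairwise
distinct partitions intersect in at most one element. -/
theorem partition_lemma_triple_intersection
    (l m : ℕ) (hl : 0 < l) (hm : 0 < m)
    (k : Fin l → ℕ) (hk : ∀ h, 0 < k h)
    (hRH : (∑ h, (k h : ℤ)) - 2 ≥ (m : ℤ) * ((l : ℤ) - 2))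
    (π : Fin l → Multiset ℕ)
    (hcard : ∀ h, (π h).card = k h)
    (hpos : ∀ h, ∀ x ∈ π h, 0 < x)
    (hsum : ∀ h, (π h).sum = m) :
    ∃ P : Fin l → Finpartition (Finset.univ : Finset (Fin m)),
      (∀ h, (P h).parts.val.map Finset.card = π h) ∧
      (∀ h₁ h₂ h₃ : Fin l, h₁ ≠ h₂ → h₁ ≠ h₃ → h₂ ≠ h₃ →
        ∀ A ∈ (P h₁).parts, ∀ B ∈ (P h₂).parts, ∀ C ∈ (P h₃).parts,
          (A ∩ B ∩ C).card ≤ 1) := by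
  choose A hA using fun h => exists_multiset_with_counts (π h) (hpos h)
  have hAm : ∀ h, (A h).card = m := fun h => by
    rw [← hsum h, ← hA h, ← Multiset.toFinset_sum_count_eq]
    rfl
  have hAk : ∀ h, (A h).toFinset.card = k h := fun h => by
    rw [← hcard h, ← hA h, Multiset.card_map]
    rfl
  have hd : ∑ h, (m - (A h).toFinset.card) + 2 ≤ 2 * m := by
    have hcast : ((∑ h, (m - (A h).toFinset.card) : ℕ) : ℤ) = (m : ℤ) * l - ∑ h, (k h : ℤ) := by
      rw [Nat.cast_sum, Finset.sum_congr rfl fun h _ => Nat.cast_sub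
        (hAm h ▸ Multiset.toFinset_card_le (A h)), Finset.sum_sub_distrib]
      simp [hAk, mul_comm]
    zify at hcast ⊢
    linarith
  obtain ⟨f, hf, hfT⟩ := exists_labellings_separating A hAm hd
  choose P hP hPf using fun h => exists_finpartition_fibers (f h) (A h) (hf h)
  refine ⟨P, fun h => (hP h).trans (hA h), ?_⟩
  intro h₁ h₂ h₃ h12 h13 h23 B₁ hB₁ B₂ hB₂ B₃ hB₃
  refine Finset.card_le_one.2 fun x hx y hy => ?_
  simp only [Finset.mem_inter] at hx hy
  refine hfT {h₁, h₂, h₃} (Finset.card_eq_three.2 ⟨h₁, h₂, h₃, h12, h13, h23, rfl⟩) x y ?_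
  intro h hh
  simp only [Finset.mem_insert, Finset.mem_singleton] at hh
  rcases hh with rfl | rfl | rfl
  · exact hPf _ _ hB₁ x hx.1.1 y hy.1.1
  · exact hPf _ _ hB₂ x hx.1.2 y hy.1.2
  · exact hPf _ _ hB₃ x hx.2 y hy.2
end

section
/- Let l and m be positive integers and let k_1, …, k_l be positive integers satisfying k_1 + ⋯ + k_l − 2 ≥ m·(l − 2) (as an inequality of integers). For each h ∈ {1,…,l} let π_h be a partition of the number m into exactly k_h parts. Then there exist set partitions Π_1, …, Π_l of the set {1,…,m} such that Π_h realizes π_h for every h and such that for every pair of distinct elements i, j ∈ {1,…,m}, the number of indices h ∈ {1,…,l} for which i and j lie in the same block of Π_h is at most 2. -/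
namespace PartitionLemma

open Finset

open scoped Classical in
/-- The labellings `f h` have fibre sizes `c h`, and two distinct points get the same label under
at most two of them. -/
def IsRealization {H : Type*} [Fintype H] {ι : H → Type*} {m : ℕ}
    (c : ∀ h, ι h → ℕ) (f : ∀ h, Fin m → ι h) : Prop :=
  (∀ h i, #{x | f h x = i} = c h i) ∧ ∀ x y, x ≠ y → #{h | f h x = f h y} ≤ 2

/-- The amount by which the sum of `g` exceeds the number of nonzero values of `g`. -/
def defect {α : Type*} [Fintype α] (g : α → ℕ) : ℕ := ∑ i, (g i - 1)

open scoped Classical in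
theorem exists_add_single_eq {α : Type*} {g : α → ℕ} {t : α} (ht : 1 ≤ g t) : ∃ g' : α → ℕ, g = g' + Pi.single t 1 := by
  refine ⟨g - Pi.single t 1, (tsub_add_cancel_of_le fun i => ?_).symm⟩
  by_cases hi : i = t
  · subst hi; simpa
  · simp [hi]

section Defect

variable {α : Type*} [Fintype α] {g : α → ℕ}

open scoped Classical in
theorem defect_add_single (g : α → ℕ) (t : α) :
    defect (g + Pi.single t 1 : α → ℕ) = defect g + if g t = 0 then 0 else 1 := by
  have h : ∀ i, (g + Pi.single t 1 : α → ℕ) i - 1 =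
      (g i - 1) + if i = t then (if g t = 0 then 0 else 1) else 0 := by
    intro i
    by_cases hi : i = t
    · subst hi
      simp only [Pi.add_apply, Pi.single_eq_same, if_true]
      split_ifs <;> omega
    · simp [hi]
  simp only [defect, h, sum_add_distrib, sum_ite_eq', mem_univ, if_true]

theorem sum_le_two_mul_defect (hg : ∀ i, g i ≠ 1) : ∑ i, g i ≤ 2 * defect g := by
  rw [defect, mul_sum]
  exact sum_le_sum fun i _ => by have := hg i; omega

theorem two_mul_sum_le_three_mul_defect (hg : ∀ i, g i ≠ 1) (hg' : ∀ i, g i ≠ 2) :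
    2 * ∑ i, g i ≤ 3 * defect g := by
  rw [defect, mul_sum, mul_sum]
  exact sum_le_sum fun i _ => by have := hg i; have := hg' i; omega

theorem exists_ne_two_le (hg : ∀ i, g i ≠ 1) (hd : defect g + 2 ≤ ∑ i, g i) :
    ∃ i j, i ≠ j ∧ 2 ≤ g i ∧ 2 ≤ g j := by
  classical
  by_contra! hcon
  obtain ⟨i, -, hi⟩ : ∃ i ∈ univ, g i ≠ 0 := exists_ne_zero_of_sum_ne_zero (by omega)
  have hi2 : 2 ≤ g i := by have := hg i; omega
  have h : ∑ j, g j ≤ ∑ j, ((g j - 1) + if j = i then 1 else 0) := by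
    refine sum_le_sum fun j _ => ?_
    split_ifs with hj
    · omega
    · have := hcon i j (Ne.symm hj) hi2
      have := hg j
      omega
  simp only [sum_add_distrib, sum_ite_eq', mem_univ, if_true] at h
  rw [defect] at hd
  omega

theorem exists_ne_eq_one (hd : 2 * defect g + 2 ≤ ∑ i, g i) :
    ∃ i j, i ≠ j ∧ g i = 1 ∧ g j = 1 := by
  classical
  by_contra! hcon
  obtain ⟨i, hi⟩ : ∃ i, g i = 1 := by
    by_contra! h
    have := sum_le_two_mul_defect h
    omega
  have h : ∑ j, g j ≤ ∑ j, (2 * (g j - 1) + if j = i then 1 else 0) := by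
    refine sum_le_sum fun j _ => ?_
    split_ifs with hj
    · omega
    · have := hcon i j (Ne.symm hj) hi
      omega
  simp only [sum_add_distrib, sum_ite_eq', mem_univ, if_true, ← mul_sum] at h
  rw [defect] at hd
  omega

open scoped Classical in
theorem exists_card_fiber_eq {m : ℕ} (hg : ∑ i, g i = m) :
    ∃ f : Fin m → α, ∀ i, #{x | f x = i} = g i := by
  have e : Fin m ≃ Σ i, Fin (g i) := Fintype.equivOfCardEq (by simp [hg])
  refine ⟨fun x => (e x).1, fun i => ?_⟩
  rw [← Fintype.card_subtype,
    Fintype.card_congr (e.subtypeEquiv (q := fun p => p.1 = i) fun _ => Iff.rfl),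
    Fintype.card_congr (Equiv.sigmaSubtype i)]
  simp

end Defect

section Realization

variable {H : Type*} [Fintype H] {ι : H → Type*} {m : ℕ}
  {c : ∀ h, ι h → ℕ} {f : ∀ h, Fin m → ι h}

theorem IsRealization.ne_zero (hf : IsRealization c f) (h : H) (x : Fin m) : c h (f h x) ≠ 0 := by
  classical
  rw [← hf.1 h, card_ne_zero]
  exact ⟨x, by simp⟩

open scoped Classical in
theorem IsRealization.cons (hf : IsRealization c f) (t : ∀ h, ι h)
    (ht : ∀ y, #{h | t h = f h y} ≤ 2) :
    IsRealization (fun h => c h + Pi.single (t h) 1)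
      (fun h => (Fin.cons (t h) (f h) : Fin (m + 1) → ι h)) := by
  refine ⟨fun h i => ?_, fun x y hxy => ?_⟩
  · rw [Fin.card_filter_univ_succ]
    simp only [Fin.cons_zero, Fin.cons_succ, hf.1, Pi.add_apply,
      Pi.single_apply, eq_comm (a := i)]
    split_ifs <;> omega
  · cases x using Fin.cases with
    | zero =>
      cases y using Fin.cases with
      | zero => exact absurd rfl hxy
      | succ y => simpa using ht y
    | succ x =>
      cases y using Fin.cases with
      | zero => simpa [eq_comm] using ht x
      | succ y => simpa using hf.2 x y (by simpa using hxy)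

open scoped Classical in
theorem exists_isRealization_of_card_le_two [∀ h, Fintype (ι h)] (hsum : ∀ h, ∑ i, c h i = m)
    (hc : #{h | ∃ i, 2 ≤ c h i} ≤ 2) : ∃ f : ∀ h, Fin m → ι h, IsRealization c f := by
  choose f hf using fun h => exists_card_fiber_eq (hsum h)
  refine ⟨f, fun h i => ?_, fun x y hxy => (card_le_card fun h hh => ?_).trans hc⟩
  · exact hf h i
  · simp only [mem_filter, mem_univ, true_and] at hh ⊢
    refine ⟨f h x, ?_⟩
    rw [← hf h]
    exact one_lt_card.2 ⟨x, by simp, y, by simp [hh], hxy⟩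

theorem exists_isRealization [∀ h, Fintype (ι h)] (m : ℕ) (c : ∀ h, ι h → ℕ)
    (hsum : ∀ h, ∑ i, c h i = m) (hd : ∑ h, defect (c h) + 2 ≤ 2 * m) :
    ∃ f : ∀ h, Fin m → ι h, IsRealization c f := by
  classical
  induction m using Nat.strong_induction_on generalizing c with
  | _ m ih =>
  by_cases hN : #{h | ∃ i, 2 ≤ c h i} ≤ 2
  · exact exists_isRealization_of_card_le_two hsum hN
  by_cases hO : #{h | ∀ i, c h i ≠ 1} ≤ 2
  · -- Remove a point lying in a nontrivial block for exactly two of the partitions.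
    have hON : filter (fun h => ∀ i, c h i ≠ 1) univ ⊆ filter (fun h => ∃ i, 2 ≤ c h i) univ := by
      intro h hh
      simp only [mem_filter, mem_univ, true_and] at hh ⊢
      obtain ⟨i, -, hi⟩ : ∃ i ∈ univ, c h i ≠ 0 :=
        exists_ne_zero_of_sum_ne_zero (by rw [hsum]; omega)
      exact ⟨i, by have := hh i; omega⟩
    obtain ⟨S, hOS, hSN, hS⟩ := exists_subsuperset_card_eq hON hO (by omega)
    have ht : ∀ h, ∃ t, (h ∈ S → 2 ≤ c h t) ∧ (h ∉ S → c h t = 1) := by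
      intro h
      by_cases hh : h ∈ S
      · obtain ⟨t, ht⟩ := (mem_filter.1 (hSN hh)).2
        exact ⟨t, fun _ => ht, fun h' => absurd hh h'⟩
      · obtain ⟨t, ht⟩ : ∃ t, c h t = 1 := by
          by_contra! h'
          exact hh (hOS (by simpa using h'))
        exact ⟨t, fun h' => absurd h' hh, fun _ => ht⟩
    choose t htS htS' using ht
    have ht1 : ∀ h, 1 ≤ c h (t h) := fun h => by
      by_cases hh : h ∈ S
      · exact (htS h hh).trans' one_le_two
      · exact (htS' h hh).ge
    choose c' hc' using fun h => exists_add_single_eq (ht1 h)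
    obtain rfl : c = fun h => c' h + Pi.single (t h) 1 := funext hc'
    clear hc'
    simp only [Pi.add_apply, Pi.single_eq_same, sum_add_distrib, sum_pi_single', mem_univ,
      if_true, defect_add_single] at hsum hd htS htS'
    obtain _ | m := m
    · omega
    have hcount : ∑ h, (if c' h (t h) = 0 then 0 else 1) = 2 := by
      rw [← hS, card_eq_sum_ones, ← sum_filter_add_sum_filter_not univ (· ∈ S)]
      rw [sum_congr rfl (g := fun _ => 1),
        sum_congr rfl (g := fun _ => 0) (s₁ := filter (· ∉ S) univ)]
      · simp
      · intro h hh
        have := htS' h (by simpa using hh)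
        rw [if_pos (by omega)]
      · intro h hh
        have := htS h (by simpa using hh)
        rw [if_neg (by omega)]
    obtain ⟨f, hf⟩ := ih m (by omega) c' (fun h => by have := hsum h; omega) (by omega)
    refine ⟨_, hf.cons t fun y => (card_le_card fun h hh => ?_).trans hS.le⟩
    by_contra hhS
    have := hf.ne_zero h y
    rw [← (mem_filter.1 hh).2] at this
    have := htS' h hhS
    omega
  · -- Three partitions have no singleton block; remove a pair forming a block of one of them.
    have hle : ∀ T : Finset H, ∑ h ∈ T, defect (c h) ≤ ∑ h, defect (c h) := fun T =>
      sum_le_sum_of_subset (subset_univ T)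
    obtain ⟨a, haO, i₀, hi₀⟩ : ∃ a, (∀ i, c a i ≠ 1) ∧ ∃ i, c a i = 2 := by
      by_contra! hcon
      obtain ⟨a, b, e, ha, hb, he, hab, hae, hbe⟩ := two_lt_card_iff.1 (not_le.1 hO)
      simp only [mem_filter, mem_univ, true_and] at ha hb he
      have h1 := two_mul_sum_le_three_mul_defect ha (hcon a ha)
      have h2 := two_mul_sum_le_three_mul_defect hb (hcon b hb)
      have h3 := two_mul_sum_le_three_mul_defect he (hcon e he)
      have h4 := hle {a, b, e}
      rw [sum_insert (by simp [hab, hae]), sum_pair hbe] at h4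
      rw [hsum] at h1 h2 h3
      omega
    obtain ⟨b, e, hb, he, hbe⟩ :=
      one_lt_card_iff.1 ((Nat.sub_lt_sub_right (by omega) (not_le.1 hO)).trans_le
        (pred_card_le_card_erase (a := a)))
    simp only [mem_erase, mem_filter, mem_univ, true_and] at hb he
    obtain ⟨hba, hbO⟩ := hb
    obtain ⟨hea, heO⟩ := he
    have ha2 := sum_le_two_mul_defect haO
    have hb2 := sum_le_two_mul_defect hbO
    have he2 := sum_le_two_mul_defect heO
    have habe := hle {a, b, e}
    rw [sum_insert (by simp [hba.symm, hea.symm]), sum_pair hbe] at habe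
    have hts : ∀ h, ∃ t s, h = a ∧ t = s ∧ c h t = 2 ∨
        (h = b ∨ h = e) ∧ t ≠ s ∧ 2 ≤ c h t ∧ 2 ≤ c h s ∨
        (h ≠ a ∧ h ≠ b ∧ h ≠ e) ∧ t ≠ s ∧ c h t = 1 ∧ c h s = 1 := by
      rw [hsum] at ha2 hb2 he2
      intro h
      by_cases h1 : h = a
      · subst h1
        exact ⟨i₀, i₀, .inl ⟨rfl, rfl, hi₀⟩⟩
      by_cases h2 : h = b
      · subst h2
        obtain ⟨t, s, hts⟩ := exists_ne_two_le hbO (by rw [hsum]; omega)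
        exact ⟨t, s, .inr (.inl ⟨.inl rfl, hts⟩)⟩
      by_cases h3 : h = e
      · subst h3
        obtain ⟨t, s, hts⟩ := exists_ne_two_le heO (by rw [hsum]; omega)
        exact ⟨t, s, .inr (.inl ⟨.inr rfl, hts⟩)⟩
      have h4 := hle {h, a, b, e}
      rw [sum_insert (by simp [h1, h2, h3]), sum_insert (by simp [hba.symm, hea.symm]),
        sum_pair hbe] at h4
      obtain ⟨t, s, hts⟩ := exists_ne_eq_one (g := c h) (by rw [hsum]; omega)
      exact ⟨t, s, .inr (.inr ⟨⟨h1, h2, h3⟩, hts⟩)⟩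
    choose t s hts using hts
    clear hle ha2 hb2 he2 habe haO hbO heO hO hN hi₀
    choose c₁ hc₁ using fun h => exists_add_single_eq (g := c h) (t := t h) (by
      obtain h' | h' | h' := hts h <;> omega)
    obtain rfl : c = fun h => c₁ h + Pi.single (t h) 1 := funext hc₁
    clear hc₁
    choose c₂ hc₂ using fun h => exists_add_single_eq (g := c₁ h) (t := s h) (by
      obtain ⟨-, hne, h'⟩ | ⟨-, hne, h'⟩ | ⟨-, hne, h'⟩ := hts h
      · rw [← hne]; simp at h'; omega
      · simp [hne.symm] at h'; omega
      · simp [hne.symm] at h'; omega)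
    obtain rfl : c₁ = fun h => c₂ h + Pi.single (s h) 1 := funext hc₂
    clear hc₂
    have hts' : ∀ h, h = a ∧ t h = s h ∧ c₂ h (t h) = 0 ∧ c₂ h (s h) = 0 ∨
        (h = b ∨ h = e) ∧ t h ≠ s h ∧ c₂ h (t h) ≠ 0 ∧ c₂ h (s h) ≠ 0 ∨
        (h ≠ a ∧ h ≠ b ∧ h ≠ e) ∧ t h ≠ s h ∧ c₂ h (t h) = 0 ∧ c₂ h (s h) = 0 := by
      intro h
      obtain ⟨hh, hne, h'⟩ | ⟨hh, hne, h'⟩ | ⟨hh, hne, h'⟩ := hts h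
      · refine .inl ⟨hh, hne, ?_⟩
        simp only [hne, Pi.add_apply, Pi.single_eq_same] at h' ⊢
        omega
      · refine .inr (.inl ⟨hh, hne, ?_⟩)
        simp only [Pi.add_apply, Pi.single_eq_same, Pi.single_eq_of_ne hne,
          Pi.single_eq_of_ne hne.symm] at h'
        omega
      · refine .inr (.inr ⟨hh, hne, ?_⟩)
        simp only [Pi.add_apply, Pi.single_eq_same, Pi.single_eq_of_ne hne,
          Pi.single_eq_of_ne hne.symm] at h'
        omega
    have hm : 2 ≤ m := by
      have ha : 2 ≤ (c₂ a + Pi.single (s a) 1 + Pi.single (t a) 1 : ι a → ℕ) (t a) := by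
        obtain ⟨-, -, h⟩ | h | h := hts a
        · exact h.ge
        · exact h.2.2.1
        · exact absurd rfl h.1.1
      refine ha.trans ?_
      rw [← hsum a]
      exact single_le_sum (f := (c₂ a + Pi.single (s a) 1 + Pi.single (t a) 1 : ι a → ℕ))
        (fun _ _ => Nat.zero_le _) (mem_univ (t a))
    obtain ⟨m, rfl⟩ := Nat.exists_eq_add_of_le' hm
    have hzero : ∀ h, h ≠ b → h ≠ e → c₂ h (t h) = 0 ∧ c₂ h (s h) = 0 := fun h h1 h2 => by
      obtain h' | h' | h' := hts' h
      · exact h'.2.2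
      · exact absurd h'.1 (by simp [h1, h2])
      · exact h'.2.2
    have hne : ∀ h, h ≠ a → t h ≠ s h := fun h h1 => by
      obtain h' | h' | h' := hts' h
      · exact absurd h'.1 h1
      · exact h'.2.1
      · exact h'.2.1
    have hdef : ∀ h, defect (c₂ h) + ((if h = a then 1 else 0) + (if h = b then 2 else 0) +
        if h = e then 2 else 0) ≤
          defect (c₂ h + Pi.single (s h) 1 + Pi.single (t h) 1 : ι h → ℕ) := by
      intro h
      rw [defect_add_single, defect_add_single]
      obtain ⟨rfl, h1, h2, h3⟩ | ⟨hh, h1, h2, h3⟩ | ⟨hh, h1, h2, h3⟩ := hts' h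
      · simp [h1, h3, hba.symm, hea.symm]
      · obtain rfl | rfl := hh
        · simp [h2, h3, hbe, hba]
        · simp [h2, h3, hbe.symm, hea]
      · simp [hh]
        omega
    have hdef' := sum_le_sum fun h (_ : h ∈ univ) => hdef h
    simp only [sum_add_distrib, sum_ite_eq', mem_univ, if_true] at hdef'
    beta_reduce at hd
    have hsum' : ∀ h, ∑ i, c₂ h i = m := fun h => by
      have := hsum h
      simp only [Pi.add_apply, sum_add_distrib, sum_pi_single', mem_univ, if_true] at this
      omega
    obtain ⟨f, hf⟩ := ih m (by omega) c₂ hsum' (by omega)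
    have hold : ∀ u : ∀ h, ι h, (∀ h, h ≠ b → h ≠ e → c₂ h (u h) = 0) →
        ∀ y, #{h | u h = f h y} ≤ 2 := by
      refine fun u hu y => (card_le_card fun h hh => ?_).trans (card_le_two (a := b) (b := e))
      have := hf.ne_zero h y
      rw [← (mem_filter.1 hh).2] at this
      grind
    refine ⟨_, (hf.cons s (hold s fun h h1 h2 => (hzero h h1 h2).2)).cons t fun y => ?_⟩
    cases y using Fin.cases with
    | zero =>
      refine (card_le_card (t := {a}) fun h hh => ?_).trans (by simp)
      by_contra hha
      exact hne h (by simpa using hha) (by simpa using hh)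
    | succ y => simpa using hold t (fun h h1 h2 => (hzero h h1 h2).1) y

end Realization

/-- The partition of the domain of a surjective map into its fibres. -/
def fiberPartition {α β : Type*} [Fintype α] [Fintype β]
    [DecidableEq α] [DecidableEq β] (f : α → β)
    (hf : Function.Surjective f) : Finpartition (univ : Finset α) where
  parts := univ.image fun i => ({x | f x = i} : Finset α)
  supIndep := by
    rw [supIndep_iff_pairwiseDisjoint]
    intro A hA B hB hAB
    simp only [coe_image, coe_univ, Set.image_univ, Set.mem_range] at hA hB
    obtain ⟨i, rfl⟩ := hA
    obtain ⟨j, rfl⟩ := hB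
    refine disjoint_left.2 fun x hx hy => hAB ?_
    simp only [id, mem_filter, mem_univ, true_and] at hx hy
    rw [← hx, hy]
  sup_parts := by
    ext x
    simp [mem_sup]
  bot_notMem := by
    simp only [bot_eq_empty, mem_image, mem_univ, true_and, not_exists]
    intro i hi
    obtain ⟨x, hx⟩ := hf i
    exact notMem_empty x (hi ▸ by simp [hx])

theorem exists_mem_fiberPartition_parts {α β : Type*} [Fintype α] [Fintype β]
    [DecidableEq α] [DecidableEq β] {f : α → β}
    (hf : Function.Surjective f) {x y : α} :
    (∃ A ∈ (fiberPartition f hf).parts, x ∈ A ∧ y ∈ A) ↔ f x = f y := by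
  simp [fiberPartition, eq_comm]

theorem map_card_fiberPartition_parts {α β : Type*} [Fintype α] [Fintype β]
    [DecidableEq α] [DecidableEq β] {f : α → β}
    (hf : Function.Surjective f) :
    (fiberPartition f hf).parts.val.map card =
      (univ : Finset β).val.map fun i => #{x | f x = i} := by
  have hinj : Function.Injective fun i => ({x | f x = i} : Finset α) := by
    intro i j hij
    obtain ⟨x, rfl⟩ := hf i
    have : x ∈ ({y | f y = j} : Finset α) := by
      rw [← show _ = ({y | f y = j} : Finset α) from hij]
      simp
    simpa using this
  rw [fiberPartition, image_val_of_injOn hinj.injOn, Multiset.map_map]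
  rfl

end PartitionLemma

/-- **Partition lemma, pairwise form of the triple intersection property.**
Let `l`, `m` be positive integers and `k 0, …, k (l-1)` positive integers with
`k 0 + ⋯ + k (l-1) - 2 ≥ m * (l - 2)` (in `ℤ`).  For each `h` let `π h` be a partition of the
number `m` into exactly `k h` (positive) parts.  Then there exist set partitions
`P 0, …, P (l-1)` of `{1, …, m}` (formalized as `Fin m`) realizing the `π h`, such that every
pair of distinct elements `i ≠ j` lies in a common block of at most two of the partitions. -/
theorem partition_lemma_pairs_in_at_most_two
    (l m : ℕ) (hl : 0 < l) (hm : 0 < m)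
    (k : Fin l → ℕ) (hk : ∀ h, 0 < k h)
    (hRH : (∑ h, (k h : ℤ)) - 2 ≥ (m : ℤ) * ((l : ℤ) - 2))
    (π : Fin l → Multiset ℕ)
    (hcard : ∀ h, (π h).card = k h)
    (hpos : ∀ h, ∀ x ∈ π h, 0 < x)
    (hsum : ∀ h, (π h).sum = m) :
    ∃ P : Fin l → Finpartition (Finset.univ : Finset (Fin m)),
      (∀ h, (P h).parts.val.map Finset.card = π h) ∧
      (∀ i j : Fin m, i ≠ j →
        Set.ncard {h : Fin l | ∃ A ∈ (P h).parts, i ∈ A ∧ j ∈ A} ≤ 2) := by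
  classical
  let c : ∀ h, (π h).ToType → ℕ := fun h i => i.1
  have hc : ∀ h, (Finset.univ : Finset (π h).ToType).val.map (c h) = π h := fun h =>
    Multiset.map_univ_coe (π h)
  have hc0 : ∀ h i, 0 < c h i := fun h i => hpos h _ (Multiset.coe_mem (x := i))
  have hcsum : ∀ h, ∑ i, c h i = m := fun h => by
    rw [Finset.sum, hc, hsum]
  have hd : ∀ h, (PartitionLemma.defect (c h) : ℤ) = m - k h := fun h => by
    have h1 : ∑ i, c h i = ∑ i, ((c h i - 1) + 1) :=
      Finset.sum_congr rfl fun i _ => by have := hc0 h i; omega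
    rw [hcsum, Finset.sum_add_distrib, ← Finset.card_eq_sum_ones, Finset.card_univ,
      Multiset.card_coe, hcard] at h1
    rw [PartitionLemma.defect]
    omega
  have hD : ∑ h, PartitionLemma.defect (c h) + 2 ≤ 2 * m := by
    zify
    simp only [hd, Finset.sum_sub_distrib, Finset.sum_const, Finset.card_univ, Fintype.card_fin,
      nsmul_eq_mul]
    linarith
  obtain ⟨f, hf, hf2⟩ := PartitionLemma.exists_isRealization m c hcsum hD
  have hsurj : ∀ h, Function.Surjective (f h) := fun h i => by
    have := hc0 h i
    rw [← hf h i, Finset.card_pos] at this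
    obtain ⟨x, hx⟩ := this
    exact ⟨x, by simpa using hx⟩
  refine ⟨fun h => PartitionLemma.fiberPartition (f h) (hsurj h), fun h => ?_, fun i j hij => ?_⟩
  · rw [PartitionLemma.map_card_fiberPartition_parts]
    simp only [hf, hc]
  · simp only [PartitionLemma.exists_mem_fiberPartition_parts]
    rw [Set.ncard_eq_toFinset_card']
    convert hf2 i j hij using 2
    ext h
    simp
end

section
/- Let T be a finite tree with vertex set V and edge set E, let d be a positive integer, and for each vertex v ∈ V let ∼_v be an equivalence relation on the set {1,…,d}. For a subset I ⊆ {1,…,d}, let T_I denote the subgraph of T induced on the vertex set {v ∈ V : i ∼_v j for all i, j ∈ I}, and let c(T_I) denote its number of connected components. Set N_V := Σ_{v ∈ V} (number of equivalence classes of ∼_v) and N_E := Σ_{{v,w} ∈ E} (number of equivalence classes of the common refinement of ∼_v and ∼_w, i.e., of the relation i ∼ j ⇔ (i ∼_v j and i ∼_w j)). Then, as an identity of integers, N_E − N_V + 1 = Σ_{I ⊆ {1,…,d}} (−1)^{|I|} c(T_I), where the summand for I with |I| ≤ 1 equals c(T) = 1. -/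
open Finset

/-- In a finite forest, vertices minus edges counts connected components. -/
theorem SimpleGraph.IsAcyclic.card_connectedComponent_add_card_edgeFinset
    {V : Type*} [Fintype V] {G : SimpleGraph V} [Fintype G.edgeSet] (hG : G.IsAcyclic) :
    Nat.card G.ConnectedComponent + #G.edgeFinset = Fintype.card V := by
  classical
  have hdeg (c : G.ConnectedComponent) :
      ∑ v : {v // G.connectedComponentMk v = c}, G.degree v + 2 =
        ∑ _v : {v // G.connectedComponentMk v = c}, 2 := by
    have hsum := (G.induce c.supp).sum_degrees_eq_twice_card_edges
    have htree : (G.induce c.supp).IsTree := hG.isTree_connectedComponent c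
    have hcard := htree.card_edgeFinset
    have hnbr (v : c.supp) : (G.induce c.supp).degree v = G.degree v := by
      refine SimpleGraph.degree_induce_of_neighborSet_subset fun w hw => ?_
      exact (SimpleGraph.ConnectedComponent.connectedComponentMk_eq_of_adj
        (G.mem_neighborSet _ _ |>.1 hw)).symm.trans v.2
    simp only [hnbr] at hsum
    have hsum' : ∑ v : {v // G.connectedComponentMk v = c}, G.degree v =
        2 * #(G.induce c.supp).edgeFinset := by
      convert hsum <;> exact Iff.rfl
    have hcard' : Fintype.card {v // G.connectedComponentMk v = c} = Fintype.card c.supp :=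
      Fintype.card_congr (Equiv.refl _)
    simp only [sum_const, card_univ, smul_eq_mul]
    omega
  have htotal := Fintype.sum_congr _ _ hdeg
  rw [sum_add_distrib, Fintype.sum_fiberwise G.connectedComponentMk (fun v => G.degree v),
    Fintype.sum_fiberwise G.connectedComponentMk (fun _ => 2)] at htotal
  have hhand := G.sum_degrees_eq_twice_card_edges
  simp only [sum_const, card_univ, smul_eq_mul] at htotal
  rw [Nat.card_eq_fintype_card]
  have hedges : #G.edgeFinset = #(@SimpleGraph.edgeFinset V G G.fintypeEdgeSet) := by congr!
  omega

open Classical in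
/-- The alternating count of the subsets contained in a single class of an equivalence relation. -/
theorem Setoid.sum_neg_one_pow_card_eq_one_sub_card_quotient
    {α : Type*} [Fintype α] (r : Setoid α) :
    ∑ I : Finset α, (if ∀ i ∈ I, ∀ j ∈ I, r i j then (-1 : ℤ) ^ #I else 0) =
      1 - Nat.card (Quotient r) := by
  have hind (I : Finset α) : (if ∀ i ∈ I, ∀ j ∈ I, r i j then (-1 : ℤ) ^ #I else 0) =
      (∑ q : Quotient r, if ∀ i ∈ I, Quotient.mk r i = q then (-1 : ℤ) ^ #I else 0) +
        if I = ∅ then 1 - (Nat.card (Quotient r) : ℤ) else 0 := by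
    rcases I.eq_empty_or_nonempty with rfl | ⟨a, ha⟩
    · simp [Nat.card_eq_fintype_card]
    rw [if_neg (ne_empty_of_mem ha), add_zero, sum_eq_single (Quotient.mk r a)]
    · refine if_congr ⟨fun h i hi => Quotient.sound (h i hi a ha), fun h i hi j hj => ?_⟩ rfl rfl
      exact Quotient.exact ((h i hi).trans (h j hj).symm)
    · exact fun q _ hq => if_neg fun h => hq (h a ha).symm
    · simp
  have hclass (q : Quotient r) :
      ∑ I : Finset α, (if ∀ i ∈ I, Quotient.mk r i = q then (-1 : ℤ) ^ #I else 0) = 0 := by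
    obtain ⟨a, rfl⟩ := Quotient.exists_rep q
    rw [← sum_filter, ← sum_powerset_neg_one_pow_card_of_nonempty
      (x := {i | Quotient.mk r i = Quotient.mk r a}) ⟨a, by simp⟩]
    refine sum_congr ?_ fun _ _ => rfl
    ext I
    simp [subset_iff]
  rw [Fintype.sum_congr _ _ hind, sum_add_distrib, sum_comm]
  simp [hclass]

/-- **Genus formula for a gluing datum over a tree.**
Let `T = (V, E)` be a finite tree, `d > 0`, and for each vertex `v` let `R v` be an equivalence
relation on `{1, …, d}` (formalized as `Fin d`).  For `I ⊆ Fin d`, let `T_I` be the subgraph of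
`T` induced on the vertices `v` at which all indices of `I` are `R v`-equivalent, and `c(T_I)`
its number of connected components.  With
`N_V = Σ_v #(classes of R v)` and
`N_E = Σ_{{v,w} ∈ E} #(classes of R v ⊓ R w)`,
one has `N_E - N_V + 1 = Σ_{I ⊆ Fin d} (-1)^|I| c(T_I)`. -/
theorem gluing_datum_genus_formula
    {V : Type*} [Fintype V] [DecidableEq V]
    (T : SimpleGraph V) [DecidableRel T.Adj]
    (hT : T.IsTree) (d : ℕ) (hd : 0 < d)
    (R : V → Setoid (Fin d)) :
    ((∑ e ∈ T.edgeFinset,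
        Sym2.lift ⟨fun v w => Nat.card (Quotient (R v ⊓ R w)),
                   fun v w => by simp only []; rw [inf_comm]⟩ e : ℕ) : ℤ)
      - ((∑ v : V, Nat.card (Quotient (R v)) : ℕ) : ℤ) + 1
    = ∑ I ∈ (Finset.univ : Finset (Finset (Fin d))),
        (-1 : ℤ) ^ I.card *
          (Nat.card
            ((T.induce {v : V | ∀ i ∈ I, ∀ j ∈ I, (R v).r i j}).ConnectedComponent) : ℤ) := by
  classical
  let edgeRel : Sym2 V → Setoid (Fin d) := Sym2.lift ⟨fun v w => R v ⊓ R w, fun v w => inf_comm _ _⟩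
  have hedge (e : Sym2 V) :
      Sym2.lift ⟨fun v w => Nat.card (Quotient (R v ⊓ R w)),
        fun v w => by simp only []; rw [inf_comm]⟩ e = Nat.card (Quotient (edgeRel e)) := by
    induction e with | _ v w => rfl
  have hcomp (I : Finset (Fin d)) :
      (Nat.card (T.induce {v : V | ∀ i ∈ I, ∀ j ∈ I, (R v).r i j}).ConnectedComponent : ℤ) =
        (∑ v : V, if ∀ i ∈ I, ∀ j ∈ I, R v i j then 1 else 0) -
          ∑ e ∈ T.edgeFinset, if ∀ i ∈ I, ∀ j ∈ I, edgeRel e i j then 1 else 0 := by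
    set S : Set V := {v : V | ∀ i ∈ I, ∀ j ∈ I, (R v).r i j} with hS
    have hforest := (hT.isAcyclic.induce S).card_connectedComponent_add_card_edgeFinset
    have hE : #(T.induce S).edgeFinset =
        #{e ∈ T.edgeFinset | ∀ i ∈ I, ∀ j ∈ I, edgeRel e i j} := by
      rw [← card_map (Function.Embedding.subtype (· ∈ S)).sym2Map,
        SimpleGraph.map_edgeFinset_induce, ← filter_mem_eq_inter]
      congr 1
      refine filter_congr fun e _ => ?_
      induction e with | _ v w =>
      simp only [mk_mem_sym2_iff, Set.mem_toFinset]
      exact ⟨fun h i hi j hj => ⟨h.1 i hi j hj, h.2 i hi j hj⟩,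
        fun h => ⟨fun i hi j hj => (h i hi j hj).1, fun i hi j hj => (h i hi j hj).2⟩⟩
    have hV : Fintype.card S = #{v : V | ∀ i ∈ I, ∀ j ∈ I, R v i j} :=
      Fintype.card_subtype _
    rw [sum_boole, sum_boole, ← hE, ← hV, ← hforest]
    push_cast
    ring
  have hclasses (r : Setoid (Fin d)) :
      ∑ I : Finset (Fin d), (if ∀ i ∈ I, ∀ j ∈ I, r i j then (-1 : ℤ) ^ #I else 0) =
        1 - Nat.card (Quotient r) := by
    convert r.sum_neg_one_pow_card_eq_one_sub_card_quotient
  have htree : (#T.edgeFinset : ℤ) + 1 = Fintype.card V := mod_cast hT.card_edgeFinset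
  simp_rw [hcomp, mul_sub, mul_sum, mul_ite, mul_one, mul_zero, hedge]
  rw [sum_sub_distrib, sum_comm, sum_comm (t := T.edgeFinset)]
  rw [Fintype.sum_congr _ _ fun v => hclasses (R v),
    sum_congr rfl fun e _ => hclasses (edgeRel e)]
  simp only [sum_sub_distrib, sum_const, card_univ, nsmul_eq_mul, mul_one]
  push_cast
  linarith
end
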